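/- The cone of completely positive matrices equals the set of entrywise nonnegative symmetric matrices that have nonnegative trace inner product with all perfect copositive matrices: CP^n = { Q ∈ N^n : ⟨P, Q⟩ ≥ 0 for all perfect copositive matrices P }. -/

import Mathlib

open Matrix

/-- The quadratic form `x ↦ xᵀ B x`. -/
def qf {n : ℕ} (B : Matrix (Fin n) (Fin n) ℝ) (x : Fin n → ℝ) : ℝ := x ⬝ᵥ B.mulVec x

/-- Coercion of an integer vector to a real vector. -/
def intCast {n : ℕ} (v : Fin n → ℤ) : Fin n → ℝ := fun i => (v i : ℝ)

/-- `B` is strictly copositive: `xᵀBx > 0` for all nonzero nonnegative `x`. -/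
def StrictlyCopositive {n : ℕ} (B : Matrix (Fin n) (Fin n) ℝ) : Prop :=
  ∀ x : Fin n → ℝ, (∀ i, 0 ≤ x i) → x ≠ 0 → 0 < qf B x

/-- The copositive minimum: infimum of `vᵀBv` over nonzero nonnegative integer vectors. -/
noncomputable def copoMin {n : ℕ} (B : Matrix (Fin n) (Fin n) ℝ) : ℝ :=
  sInf {r : ℝ | ∃ v : Fin n → ℤ, (∀ i, 0 ≤ v i) ∧ v ≠ 0 ∧ r = qf B (intCast v)}

/-- The set of nonzero nonnegative integer vectors attaining the copositive minimum. -/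
def MinCOP {n : ℕ} (B : Matrix (Fin n) (Fin n) ℝ) : Set (Fin n → ℤ) :=
  {v | (∀ i, 0 ≤ v i) ∧ v ≠ 0 ∧ qf B (intCast v) = copoMin B}

/-- `B` is perfect copositive: strictly copositive and uniquely determined among
symmetric matrices by the equations `vᵀQv = copoMin B` for `v ∈ MinCOP B`. -/
def IsPerfectCopositive {n : ℕ} (B : Matrix (Fin n) (Fin n) ℝ) : Prop :=
  B.IsSymm ∧ StrictlyCopositive B ∧
    ∀ Q : Matrix (Fin n) (Fin n) ℝ, Q.IsSymm →
      (∀ v ∈ MinCOP B, qf Q (intCast v) = copoMin B) → Q = B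

/-- The cone of completely positive matrices: nonnegative combinations of `xxᵀ`
with `x` in the nonnegative orthant. -/
def CPcone (n : ℕ) : Set (Matrix (Fin n) (Fin n) ℝ) :=
  {A | ∃ (m : ℕ) (α : Fin m → ℝ) (x : Fin m → Fin n → ℝ),
    (∀ i, 0 ≤ α i) ∧ (∀ i j, 0 ≤ x i j) ∧ A = ∑ i, α i • Matrix.vecMulVec (x i) (x i)}

open Filter Topology

lemma qf_add_smul {n : ℕ} (X D : Matrix (Fin n) (Fin n) ℝ) (t : ℝ) (x : Fin n → ℝ) :
    qf (X + t • D) x = qf X x + t * qf D x := by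
  simp [qf, Matrix.add_mulVec, Matrix.smul_mulVec, dotProduct_add, dotProduct_smul]

lemma qf_smul_vec {n : ℕ} (B : Matrix (Fin n) (Fin n) ℝ) (c : ℝ) (x : Fin n → ℝ) :
    qf B (c • x) = c ^ 2 * qf B x := by
  simp [qf, Matrix.mulVec_smul, dotProduct_smul, smul_dotProduct]; ring

lemma qf_add_vec {n : ℕ} {B : Matrix (Fin n) (Fin n) ℝ} (hB : B.IsSymm) (x y : Fin n → ℝ) :
    qf B (x + y) = qf B x + 2 * (y ⬝ᵥ B.mulVec x) + qf B y := by
  have h : x ⬝ᵥ B.mulVec y = y ⬝ᵥ B.mulVec x := by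
    rw [dotProduct_comm y, ← Matrix.vecMul_transpose B x, hB.eq, ← Matrix.dotProduct_mulVec]
  simp only [qf, Matrix.mulVec_add, dotProduct_add, add_dotProduct, h]; ring

lemma qf_continuous {n : ℕ} (B : Matrix (Fin n) (Fin n) ℝ) : Continuous (qf B) := by
  unfold qf
  simp only [dotProduct, Matrix.mulVec]
  fun_prop

lemma qf_zero {n : ℕ} (B : Matrix (Fin n) (Fin n) ℝ) : qf B 0 = 0 := by simp [qf]

lemma qf_single {n : ℕ} (B : Matrix (Fin n) (Fin n) ℝ) (i : Fin n) (c : ℝ) :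
    qf B (Pi.single i c) = c ^ 2 * B i i := by
  simp [qf]; ring

def Copos {n : ℕ} (B : Matrix (Fin n) (Fin n) ℝ) : Prop :=
  ∀ x : Fin n → ℝ, (∀ i, 0 ≤ x i) → 0 ≤ qf B x

def InR {n : ℕ} (X : Matrix (Fin n) (Fin n) ℝ) : Prop :=
  X.IsSymm ∧ ∀ v : Fin n → ℤ, (∀ i, 0 ≤ v i) → v ≠ 0 → 1 ≤ qf X (intCast v)

lemma copos_diag {n : ℕ} {B : Matrix (Fin n) (Fin n) ℝ} (hB : Copos B) (i : Fin n) :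
    0 ≤ B i i := by
  have := hB (Pi.single i 1) (fun j => by by_cases h : j = i <;> simp [h])
  rw [qf_single] at this; linarith

/-- Linear-in-ε trick. -/
lemma lin_trick {a b : ℝ} (h : ∀ e : ℝ, 0 < e → 0 ≤ 2 * e * a + e ^ 2 * b) : 0 ≤ a := by
  by_contra ha
  push Not at ha
  have hb : 0 < |b| + 1 := by positivity
  have h1 := h (-a / (|b| + 1)) (by apply div_pos <;> linarith)
  set e := -a / (|b| + 1) with he
  have hep : 0 < e := by apply div_pos <;> linarith
  have h2 : e * (|b| + 1) = -a := by rw [he]; field_simp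
  have h3 : b ≤ |b| := le_abs_self b
  have h4 : 0 ≤ e * (2 * a + e * b) := by nlinarith
  have h5 : 0 ≤ 2 * a + e * b := by
    by_contra h6; push Not at h6; nlinarith
  nlinarith

lemma copos_mulVec_nonneg {n : ℕ} {B : Matrix (Fin n) (Fin n) ℝ} (hs : B.IsSymm) (hB : Copos B)
    {x : Fin n → ℝ} (hx : ∀ i, 0 ≤ x i) (h0 : qf B x = 0) (i : Fin n) :
    0 ≤ B.mulVec x i := by
  apply lin_trick (b := B i i)
  intro e he
  have := hB (x + Pi.single i e) (fun j => by
    have := hx j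
    by_cases h : j = i <;> simp [h] <;> grind)
  rw [qf_add_vec hs, h0, qf_single] at this
  simp only [single_dotProduct] at this
  linarith

lemma copos_zero {n : ℕ} {B : Matrix (Fin n) (Fin n) ℝ} (hs : B.IsSymm) (hB : Copos B)
    {x : Fin n → ℝ} (hx : ∀ i, 0 ≤ x i) (h0 : qf B x = 0) (i : Fin n) :
    x i * B.mulVec x i = 0 := by
  have h1 : ∑ i, x i * B.mulVec x i = 0 := h0
  exact (Finset.sum_eq_zero_iff_of_nonneg (fun i _ =>
    mul_nonneg (hx i) (copos_mulVec_nonneg hs hB hx h0 i))).1 h1 i (Finset.mem_univ _)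

lemma InR.copos {n : ℕ} {X : Matrix (Fin n) (Fin n) ℝ} (hX : InR X) : Copos X := by
  intro x hx
  have hlim : Tendsto (fun k : ℕ => qf X (fun i => (⌊x i * (k : ℝ)⌋₊ : ℝ) / (k : ℝ))) atTop
      (𝓝 (qf X x)) := by
    apply ((qf_continuous X).tendsto x).comp
    rw [tendsto_pi_nhds]
    intro i
    exact (tendsto_nat_floor_mul_div_atTop (hx i)).comp tendsto_natCast_atTop_atTop
  refine ge_of_tendsto' hlim fun k => ?_
  have : (fun i => (⌊x i * (k : ℝ)⌋₊ : ℝ) / (k : ℝ))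
      = (k : ℝ)⁻¹ • intCast (fun i => (⌊x i * (k : ℝ)⌋₊ : ℤ)) := by
    ext i; simp [intCast, div_eq_inv_mul]
  rw [this, qf_smul_vec]
  apply mul_nonneg (by positivity)
  by_cases hv : (fun i => (⌊x i * (k : ℝ)⌋₊ : ℤ)) = 0
  · have h0 : intCast (0 : Fin n → ℤ) = 0 := by ext i; simp [intCast]
    rw [hv, h0, qf_zero]
  · have := hX.2 _ (fun i => by positivity) hv
    linarith

lemma dirichlet {n : ℕ} (x : Fin n → ℝ) {ε : ℝ} (hε : 0 < ε) :
    ∃ k : ℕ, 0 < k ∧ ∃ v : Fin n → ℤ, ∀ i, |(v i : ℝ) - k * x i| < ε := by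
  have hc : IsCompact (Set.Icc (0 : Fin n → ℝ) 1) := isCompact_Icc
  obtain ⟨a, -, φ, hφ, hlim⟩ := hc.tendsto_subseq
    (x := fun k : ℕ => fun i => Int.fract ((k : ℝ) * x i))
    (fun k => ⟨fun i => Int.fract_nonneg _, fun i => (Int.fract_lt_one _).le⟩)
  have hcs := hlim.cauchySeq
  rw [Metric.cauchySeq_iff] at hcs
  obtain ⟨N, hN⟩ := hcs ε hε
  have hd := hN (N + 1) (by omega) N le_rfl
  have hlt : φ N < φ (N + 1) := hφ (by omega)
  refine ⟨φ (N + 1) - φ N, by omega,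
    fun i => ⌊(φ (N + 1) : ℝ) * x i⌋ - ⌊(φ N : ℝ) * x i⌋, fun i => ?_⟩
  have h1 := (dist_le_pi_dist _ _ i).trans_lt hd
  rw [Real.dist_eq] at h1
  simp only [Function.comp, Int.fract] at h1
  rw [Nat.cast_sub hlt.le]
  push_cast
  rw [abs_lt] at h1 ⊢
  constructor <;> linarith

lemma InR.strict {n : ℕ} {X : Matrix (Fin n) (Fin n) ℝ} (hX : InR X) : StrictlyCopositive X := by
  intro x hx hx0
  refine lt_of_le_of_ne (hX.copos x hx) fun h0 => ?_
  have h0 := h0.symm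
  obtain ⟨j, hj⟩ : ∃ j, x j ≠ 0 := by
    by_contra h; push Not at h; exact hx0 (funext h)
  have hjp : 0 < x j := lt_of_le_of_ne (hx j) hj.symm
  have hcont := Metric.continuous_iff.1 (qf_continuous X) 0 1 one_pos
  obtain ⟨ε, hε, hcont⟩ := hcont
  obtain ⟨k, hk, v, hv⟩ := dirichlet x (ε := min ε (min 1 (x j))) (by positivity)
  have hk1 : (1 : ℝ) ≤ k := by exact_mod_cast hk
  have hv1 : ∀ i, |(v i : ℝ) - k * x i| < 1 := fun i =>
    (hv i).trans_le ((min_le_right _ _).trans (min_le_left _ _))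
  have hvn : ∀ i, 0 ≤ v i := by
    intro i
    have h1 := (abs_lt.1 (hv1 i)).1
    have h2 : 0 ≤ (k : ℝ) * x i := mul_nonneg (by linarith) (hx i)
    have h3 : (-1 : ℝ) < v i := by linarith
    have h4 : (-1 : ℤ) < v i := by exact_mod_cast h3
    omega
  have hv0 : v ≠ 0 := by
    rintro rfl
    have h1 := (hv j).trans_le ((min_le_right _ _).trans (min_le_right _ _))
    simp only [Pi.zero_apply, Int.cast_zero, zero_sub, abs_neg] at h1
    rw [abs_of_nonneg (by positivity)] at h1
    nlinarith
  have h1 := hX.2 v hvn hv0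
  set w : Fin n → ℝ := fun i => (v i : ℝ) - k * x i with hw
  have hvw : intCast v = (k : ℝ) • x + w := by ext i; simp [intCast, hw]
  have hwx : w ⬝ᵥ X.mulVec ((k : ℝ) • x) = 0 := by
    rw [Matrix.mulVec_smul, dotProduct_smul]
    have : w ⬝ᵥ X.mulVec x = 0 := by
      apply Finset.sum_eq_zero
      intro i _
      rcases mul_eq_zero.1 (copos_zero hX.1 hX.copos hx h0 i) with h | h
      · have h2 := hv1 i
        rw [h, mul_zero, sub_zero] at h2
        have h3 : |v i| < 1 := by exact_mod_cast h2
        have h4 : v i = 0 := by rwa [Int.abs_lt_one_iff] at h3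
        simp [hw, h, h4]
      · rw [h, mul_zero]
    rw [this, smul_zero]
  rw [hvw, qf_add_vec hX.1, qf_smul_vec, h0, hwx] at h1
  have h2 := hcont w (by
    rw [dist_zero_right, pi_norm_lt_iff hε]
    intro i
    exact (hv i).trans_le (min_le_left _ _))
  rw [qf_zero, dist_zero_right, Real.norm_eq_abs] at h2
  have := (abs_lt.1 h2).2
  linarith

/-- uniform lower bound -/
lemma strict_bound {n : ℕ} {X : Matrix (Fin n) (Fin n) ℝ} (hX : StrictlyCopositive X) :
    ∃ c : ℝ, 0 < c ∧ ∀ x : Fin n → ℝ, (∀ i, 0 ≤ x i) → c * ‖x‖ ^ 2 ≤ qf X x := by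
  have hc : IsCompact (Metric.sphere (0 : Fin n → ℝ) 1 ∩ {x | ∀ i, 0 ≤ x i}) := by
    apply (isCompact_sphere _ _).inter_right
    simp only [Set.ofPred_forall]
    exact isClosed_iInter fun i => isClosed_le continuous_const (continuous_apply i)
  have key : ∃ c : ℝ, 0 < c ∧ ∀ x ∈ Metric.sphere (0 : Fin n → ℝ) 1 ∩ {x | ∀ i, 0 ≤ x i},
      c ≤ qf X x := by
    rcases Set.eq_empty_or_nonempty (Metric.sphere (0 : Fin n → ℝ) 1 ∩ {x | ∀ i, 0 ≤ x i})
      with he | hne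
    · exact ⟨1, one_pos, by simp [he]⟩
    · obtain ⟨x, hx, hmin⟩ := hc.exists_isMinOn hne (qf_continuous X).continuousOn
      refine ⟨qf X x, hX x hx.2 ?_, fun y hy => hmin hy⟩
      rintro rfl
      simpa using hx.1
  obtain ⟨c, hc0, hc⟩ := key
  refine ⟨c, hc0, fun x hx => ?_⟩
  rcases eq_or_ne x 0 with rfl | hx0
  · simp [qf_zero]
  have hp : 0 < ‖x‖ := norm_pos_iff.2 hx0
  have h1 := hc (‖x‖⁻¹ • x) ⟨by simp [norm_smul, hp.ne'], fun i => by
    have := hx i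
    simp only [Pi.smul_apply, smul_eq_mul]; positivity⟩
  rw [qf_smul_vec] at h1
  have h2 : ‖x‖ ^ 2 * (‖x‖⁻¹ ^ 2 * qf X x) = qf X x := by field_simp
  rw [← h2, mul_comm c]
  gcongr

lemma one_le_norm_intCast {n : ℕ} {v : Fin n → ℤ} (hv : v ≠ 0) : 1 ≤ ‖intCast v‖ := by
  obtain ⟨j, hj⟩ : ∃ j, v j ≠ 0 := by
    by_contra h; push Not at h; exact hv (funext h)
  refine le_trans ?_ (norm_le_pi_norm (intCast v) j)
  rw [Real.norm_eq_abs, intCast]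
  exact_mod_cast Int.one_le_abs hj

lemma qf_upper {n : ℕ} (D : Matrix (Fin n) (Fin n) ℝ) :
    ∃ C : ℝ, 0 < C ∧ ∀ x : Fin n → ℝ, -(C * ‖x‖ ^ 2) ≤ qf D x := by
  refine ⟨∑ i, ∑ j, |D i j| + 1, by positivity, fun x => ?_⟩
  have : |qf D x| ≤ (∑ i, ∑ j, |D i j|) * ‖x‖ ^ 2 := by
    simp only [qf, dotProduct, Matrix.mulVec, Finset.mul_sum, Finset.sum_mul]
    refine (Finset.abs_sum_le_sum_abs _ _).trans (Finset.sum_le_sum fun i _ => ?_)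
    refine (Finset.abs_sum_le_sum_abs _ _).trans (Finset.sum_le_sum fun j _ => ?_)
    have h1 : |x i| ≤ ‖x‖ := norm_le_pi_norm x i
    have h2 : |x j| ≤ ‖x‖ := norm_le_pi_norm x j
    rw [abs_mul, abs_mul]
    calc |x i| * (|D i j| * |x j|) ≤ ‖x‖ * (|D i j| * ‖x‖) := by gcongr
      _ = _ := by ring
  have h2 := (abs_le.1 this).1
  nlinarith [sq_nonneg ‖x‖]

lemma hit {n : ℕ} {X D : Matrix (Fin n) (Fin n) ℝ} (hX : InR X) (hDs : D.IsSymm)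
    (hD : ¬ Copos D) : ∃ t : ℝ, 0 ≤ t ∧ InR (X + t • D) ∧ ∃ v : Fin n → ℤ, (∀ i, 0 ≤ v i) ∧ v ≠ 0 ∧
      qf (X + t • D) (intCast v) = 1 ∧ qf D (intCast v) ≠ 0 := by
  set T : Set ℝ := {t | 0 ≤ t ∧ InR (X + t • D)} with hT
  have hsym : ∀ t : ℝ, (X + t • D).IsSymm := fun t => hX.1.add (hDs.smul t)
  have h0T : (0 : ℝ) ∈ T := ⟨le_rfl, by simpa using hX⟩
  have hbdd : BddAbove T := by
    unfold Copos at hD; push Not at hD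
    obtain ⟨x, hx, hneg⟩ := hD
    refine ⟨qf X x / (-qf D x), fun t ht => ?_⟩
    have := ht.2.copos x hx
    rw [qf_add_smul] at this
    rw [le_div_iff₀ (by linarith)]
    linarith
  have hclosed : IsClosed T := by
    have : T = {t | 0 ≤ t} ∩ ⋂ v : {v : Fin n → ℤ // (∀ i, 0 ≤ v i) ∧ v ≠ 0},
        {t | 1 ≤ qf X (intCast v.1) + t * qf D (intCast v.1)} := by
      ext t
      simp only [hT, InR, Set.mem_ofPred_eq, Set.mem_inter_iff, Set.mem_iInter, hsym, true_and,
        Subtype.forall, qf_add_smul]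
      tauto
    rw [this]
    refine (isClosed_le continuous_const continuous_id).inter (isClosed_iInter fun v => ?_)
    exact isClosed_le continuous_const (by fun_prop)
  have hmem : sSup T ∈ T := hclosed.csSup_mem ⟨0, h0T⟩ hbdd
  set t := sSup T with ht
  refine ⟨t, hmem.1, hmem.2, ?_⟩
  by_contra hno
  push Not at hno
  set Y := X + t • D with hY
  obtain ⟨c, hc, hcb⟩ := strict_bound hmem.2.strict
  obtain ⟨C, hC, hCb⟩ := qf_upper D
  obtain ⟨N, hN⟩ := exists_nat_gt (2 / c + 1)
  have hfin : (Set.Icc (0 : Fin n → ℤ) (fun _ => (N : ℤ))).Finite := Set.finite_Icc _ _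
  have hev : ∀ᶠ d : ℝ in 𝓝[>] 0, ∀ v ∈ Set.Icc (0 : Fin n → ℤ) (fun _ => (N : ℤ)), v ≠ 0 →
      1 ≤ qf Y (intCast v) + d * qf D (intCast v) := by
    rw [Filter.eventually_all_finite hfin]
    intro v hv
    by_cases hv0 : v = 0
    · simp [hv0]
    have h1 := hmem.2.2 v hv.1 hv0
    rcases h1.eq_or_lt with h | h
    · have := hno v hv.1 hv0 h.symm
      simp only [this, mul_zero, add_zero]
      exact Eventually.of_forall fun _ _ => h1
    · have hct : Tendsto (fun d : ℝ => qf Y (intCast v) + d * qf D (intCast v)) (𝓝[>] 0)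
          (𝓝 (qf Y (intCast v) + 0 * qf D (intCast v))) := by
        apply Tendsto.mono_left _ nhdsWithin_le_nhds
        exact Continuous.tendsto (by fun_prop) 0
      filter_upwards [hct.eventually (lt_mem_nhds (by simpa using h))] with d hd _
      exact hd.le
  have hsmall : ∀ᶠ d : ℝ in 𝓝[>] 0, d < c / (2 * C) := 
    (eventually_lt_nhds (by positivity)).filter_mono nhdsWithin_le_nhds
  obtain ⟨d, ⟨hd1, hd2⟩, hd3⟩ := ((hev.and hsmall).and self_mem_nhdsWithin).exists
  have hd3 : 0 < d := hd3
  have : t + d ∈ T := by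
    refine ⟨by linarith [hmem.1], hsym _, fun v hv hv0 => ?_⟩
    have he : X + (t + d) • D = Y + d • D := by rw [hY, add_smul, add_assoc]
    rw [he, qf_add_smul]
    by_cases hvN : v ∈ Set.Icc (0 : Fin n → ℤ) (fun _ => (N : ℤ))
    · exact hd1 v hvN hv0
    · obtain ⟨j, hj⟩ : ∃ j, (N : ℤ) < v j := by
        by_contra h; push Not at h; exact hvN ⟨hv, h⟩
      have hj' : (N : ℝ) < v j := by exact_mod_cast hj
      have hn1 : (v j : ℝ) ≤ ‖intCast v‖ := (le_abs_self _).trans (norm_le_pi_norm (intCast v) j)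
      have hcp : 0 < 2 / c := by positivity
      have hn2 : 2 / c ≤ ‖intCast v‖ ^ 2 := by nlinarith
      have hA := hcb (intCast v) (fun i => by simpa [intCast] using hv i)
      have hB := hCb (intCast v)
      rw [lt_div_iff₀ (by positivity)] at hd2
      rw [div_le_iff₀ hc] at hn2
      have hE : d * (-(C * ‖intCast v‖ ^ 2)) ≤ d * qf D (intCast v) := by gcongr
      nlinarith [mul_le_mul_of_nonneg_right hd2.le (sq_nonneg ‖intCast v‖)]
  have := le_csSup hbdd this
  linarith

/-- Directions along which all active constraints stay active. -/
def Lsub {n : ℕ} (X : Matrix (Fin n) (Fin n) ℝ) : Submodule ℝ (Matrix (Fin n) (Fin n) ℝ) where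
  carrier := {D | D.IsSymm ∧ ∀ v : Fin n → ℤ, (∀ i, 0 ≤ v i) → v ≠ 0 → qf X (intCast v) = 1 →
    qf D (intCast v) = 0}
  zero_mem' := ⟨Matrix.isSymm_zero, fun v _ _ _ => by simp [qf]⟩
  add_mem' := by
    rintro A B ⟨hA, hA'⟩ ⟨hB, hB'⟩
    refine ⟨hA.add hB, fun v h1 h2 h3 => ?_⟩
    have := qf_add_smul A B 1 (intCast v)
    rw [one_smul] at this
    rw [this, hA' v h1 h2 h3, hB' v h1 h2 h3]; simp
  smul_mem' := by
    rintro c A ⟨hA, hA'⟩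
    refine ⟨hA.smul c, fun v h1 h2 h3 => ?_⟩
    have := qf_add_smul 0 A c (intCast v)
    rw [zero_add] at this
    rw [this, hA' v h1 h2 h3]; simp [qf]

lemma mem_Lsub {n : ℕ} {X D : Matrix (Fin n) (Fin n) ℝ} : D ∈ Lsub X ↔
    D.IsSymm ∧ ∀ v : Fin n → ℤ, (∀ i, 0 ≤ v i) → v ≠ 0 → qf X (intCast v) = 1 →
    qf D (intCast v) = 0 := Iff.rfl

lemma step {n : ℕ} {X D : Matrix (Fin n) (Fin n) ℝ} (hX : InR X) (hD : D ∈ Lsub X)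
    (hDc : ¬ Copos D) : ∃ t : ℝ, 0 ≤ t ∧ InR (X + t • D) ∧
      Module.finrank ℝ (Lsub (X + t • D)) < Module.finrank ℝ (Lsub X) := by
  obtain ⟨t, ht, hR, v, hv, hv0, hv1, hvD⟩ := hit hX hD.1 hDc
  refine ⟨t, ht, hR, Submodule.finrank_lt_finrank_of_lt (lt_of_le_of_ne ?_ ?_)⟩
  · intro A hA
    refine ⟨hA.1, fun w h1 h2 h3 => hA.2 w h1 h2 ?_⟩
    rw [qf_add_smul, hD.2 w h1 h2 h3, h3]; simp
  · intro he
    rw [← he] at hD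
    exact hvD (hD.2 v hv hv0 hv1)

lemma qf_vecMulVec {n : ℕ} (u w x : Fin n → ℝ) :
    qf (Matrix.vecMulVec u w) x = (u ⬝ᵥ x) * (w ⬝ᵥ x) := by
  rw [qf, Matrix.vecMulVec_mulVec]
  simp [dotProduct_comm x u, mul_comm]

lemma qf_add_mat {n : ℕ} (X D : Matrix (Fin n) (Fin n) ℝ) (x : Fin n → ℝ) :
    qf (X + D) x = qf X x + qf D x := by
  have := qf_add_smul X D 1 x
  rwa [one_smul, one_mul] at this

lemma qf_neg_mat {n : ℕ} (D : Matrix (Fin n) (Fin n) ℝ) (x : Fin n → ℝ) :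
    qf (-D) x = - qf D x := by
  simp [qf, Matrix.neg_mulVec]

/-- The part of `D` belonging to row/column `i`; its form is `2 x_i (D x)_i`. -/
def Mrow {n : ℕ} (D : Matrix (Fin n) (Fin n) ℝ) (i : Fin n) : Matrix (Fin n) (Fin n) ℝ :=
  Matrix.vecMulVec (Pi.single i 1) (D i) + Matrix.vecMulVec (D i) (Pi.single i 1)

lemma qf_Mrow {n : ℕ} (D : Matrix (Fin n) (Fin n) ℝ) (i : Fin n) (x : Fin n → ℝ) :
    qf (Mrow D i) x = 2 * (x i * D.mulVec x i) := by
  rw [Mrow, qf_add_mat, qf_vecMulVec, qf_vecMulVec]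
  simp [Matrix.mulVec]; ring

lemma Mrow_symm {n : ℕ} (D : Matrix (Fin n) (Fin n) ℝ) (i : Fin n) : (Mrow D i).IsSymm := by
  unfold Mrow Matrix.IsSymm
  rw [Matrix.transpose_add, Matrix.transpose_vecMulVec, Matrix.transpose_vecMulVec, add_comm]

lemma Mrow_mem {n : ℕ} {X D : Matrix (Fin n) (Fin n) ℝ} (hD : D ∈ Lsub X) (hc : Copos D)
    (i : Fin n) : Mrow D i ∈ Lsub X := by
  refine ⟨Mrow_symm D i, fun v h1 h2 h3 => ?_⟩
  rw [qf_Mrow, copos_zero hD.1 hc (fun i => by simpa [intCast] using h1 i) (hD.2 v h1 h2 h3) i,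
    mul_zero]

lemma single_nonneg' {n : ℕ} (i : Fin n) {c : ℝ} (hc : 0 ≤ c) (j : Fin n) :
    0 ≤ (Pi.single i c : Fin n → ℝ) j := by
  by_cases h : j = i
  · subst h; simpa
  · simp [h]

lemma row_nonneg_of_zero {n : ℕ} {D : Matrix (Fin n) (Fin n) ℝ} (hs : D.IsSymm) (hc : Copos D)
    {i : Fin n} (hi : D i i = 0) (j : Fin n) : 0 ≤ D i j := by
  have := copos_mulVec_nonneg hs hc (x := Pi.single i 1) (single_nonneg' i zero_le_one)
    (by rw [qf_single, hi, mul_zero]) j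
  simpa [hs.apply] using this

lemma row_nonneg_of_Mrow {n : ℕ} {D : Matrix (Fin n) (Fin n) ℝ} (hc : Copos D)
    {i : Fin n} (hi : Copos (Mrow D i)) (j : Fin n) : 0 ≤ D i j := by
  by_cases hij : i = j
  · subst hij; exact copos_diag hc i
  apply lin_trick (b := 2 * D i i)
  intro e he
  have := hi (Pi.single j 1 + Pi.single i e) (fun k =>
    add_nonneg (single_nonneg' j zero_le_one k) (single_nonneg' i he.le k))
  rw [qf_Mrow] at this
  simp [Matrix.mulVec_add, hij] at this
  nlinarith

lemma neg_Mrow_not {n : ℕ} {D : Matrix (Fin n) (Fin n) ℝ} (hc : Copos D)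
    {i : Fin n} (hi : D i i ≠ 0) : ¬ Copos (- Mrow D i) := by
  intro h
  have h1 := h (Pi.single i 1) (single_nonneg' i zero_le_one)
  rw [qf_neg_mat, qf_Mrow] at h1
  simp at h1
  exact hi (le_antisymm (by linarith) (copos_diag hc i))

lemma copos_pointed {n : ℕ} {D : Matrix (Fin n) (Fin n) ℝ} (hs : D.IsSymm) (h1 : Copos D)
    (h2 : Copos (-D)) : D = 0 := by
  have hd : ∀ i, D i i = 0 := fun i => le_antisymm
    (by simpa using copos_diag h2 i) (copos_diag h1 i)
  ext i j
  apply le_antisymm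
  · simpa using row_nonneg_of_zero hs.neg h2 (i := i) (by simp [hd i]) j
  · exact row_nonneg_of_zero hs h1 (hd i) j

lemma trace_nonneg_of_entries {n : ℕ} {D Q : Matrix (Fin n) (Fin n) ℝ} (hD : ∀ i j, 0 ≤ D i j)
    (hQ : ∀ i j, 0 ≤ Q i j) : 0 ≤ Matrix.trace (D * Q) := by
  simp only [Matrix.trace, Matrix.diag, Matrix.mul_apply]
  exact Finset.sum_nonneg fun i _ => Finset.sum_nonneg fun j _ => mul_nonneg (hD _ _) (hQ _ _)

lemma perfect_of_bot {n : ℕ} (hn : 0 < n) {X : Matrix (Fin n) (Fin n) ℝ} (hX : InR X)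
    (hL : Lsub X = ⊥) : IsPerfectCopositive X := by
  obtain ⟨v, hv, hv0, hv1⟩ : ∃ v : Fin n → ℤ, (∀ i, 0 ≤ v i) ∧ v ≠ 0 ∧ qf X (intCast v) = 1 := by
    by_contra h
    push Not at h
    have h1 : (1 : Matrix (Fin n) (Fin n) ℝ) ∈ Lsub X :=
      ⟨Matrix.isSymm_one, fun v a b c => absurd c (h v a b)⟩
    rw [hL, Submodule.mem_bot] at h1
    have := congrFun (congrFun h1 ⟨0, hn⟩) ⟨0, hn⟩
    simp at this
  have hmin : copoMin X = 1 := by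
    apply IsLeast.csInf_eq
    refine ⟨⟨v, hv, hv0, hv1.symm⟩, ?_⟩
    rintro r ⟨w, hw, hw0, rfl⟩
    exact hX.2 w hw hw0
  refine ⟨hX.1, hX.strict, fun Y hY h => ?_⟩
  have hm : Y - X ∈ Lsub X := by
    refine ⟨hY.sub hX.1, fun w h1 h2 h3 => ?_⟩
    have h4 := h w ⟨h1, h2, by rw [hmin, h3]⟩
    rw [sub_eq_add_neg, qf_add_mat, qf_neg_mat, h4, h3, hmin]; ring
  rw [hL, Submodule.mem_bot] at hm
  exact sub_eq_zero.1 hm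

lemma main_ineq {n : ℕ} {Q : Matrix (Fin n) (Fin n) ℝ} (hQ : ∀ i j, 0 ≤ Q i j)
    (hP : ∀ P : Matrix (Fin n) (Fin n) ℝ, IsPerfectCopositive P → 0 ≤ Matrix.trace (P * Q)) :
    ∀ (d : ℕ) (X : Matrix (Fin n) (Fin n) ℝ), Module.finrank ℝ (Lsub X) = d → InR X →
      0 ≤ Matrix.trace (X * Q) := by
  intro d
  induction d using Nat.strong_induction_on with
  | _ d ih =>
  intro X hd hX
  rcases Nat.eq_zero_or_pos n with rfl | hn
  · simp [Matrix.trace]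
  by_cases hL : Lsub X = ⊥
  · exact hP X (perfect_of_bot hn hX hL)
  obtain ⟨D, hD, hD0⟩ := (Submodule.ne_bot_iff _).1 hL
  have go : ∀ D ∈ Lsub X, ¬ Copos D → ∃ t : ℝ, 0 ≤ t ∧
      0 ≤ Matrix.trace (X * Q) + t * Matrix.trace (D * Q) := by
    intro D hD hDc
    obtain ⟨t, ht, hR, hlt⟩ := step hX hD hDc
    refine ⟨t, ht, ?_⟩
    have := ih _ (hd ▸ hlt) _ rfl hR
    simpa [add_mul, Matrix.trace_add, Matrix.trace_smul] using this
  have both : ∀ D ∈ Lsub X, ¬ Copos D → ¬ Copos (-D) → 0 ≤ Matrix.trace (X * Q) := by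
    intro D hD h1 h2
    obtain ⟨t, ht, h3⟩ := go D hD h1
    obtain ⟨s, hs, h4⟩ := go (-D) (neg_mem hD) h2
    rw [neg_mul, Matrix.trace_neg] at h4
    rcases le_total 0 (Matrix.trace (D * Q)) with h | h
    · nlinarith [mul_nonneg hs h]
    · nlinarith [mul_nonneg ht (neg_nonneg.2 h)]
  have one : ∀ D ∈ Lsub X, D ≠ 0 → Copos D → 0 ≤ Matrix.trace (X * Q) := by
    intro D hD hD0 hc
    by_cases hM : ∃ i, D i i ≠ 0 ∧ ¬ Copos (Mrow D i)
    · obtain ⟨i, hi, hMi⟩ := hM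
      exact both _ (Mrow_mem hD hc i) hMi (neg_Mrow_not hc hi)
    · push Not at hM
      have hent : ∀ i j, 0 ≤ D i j := by
        intro i j
        by_cases hi : D i i = 0
        · exact row_nonneg_of_zero hD.1 hc hi j
        · exact row_nonneg_of_Mrow hc (hM i hi) j
      obtain ⟨s, hs, h4⟩ := go (-D) (neg_mem hD) (fun h => hD0 (copos_pointed hD.1 hc h))
      rw [neg_mul, Matrix.trace_neg] at h4
      nlinarith [mul_nonneg hs (trace_nonneg_of_entries hent hQ)]
  by_cases h1 : Copos D
  · exact one D hD hD0 h1
  by_cases h2 : Copos (-D)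
  · exact one (-D) (neg_mem hD) (neg_ne_zero.2 hD0) h2
  · exact both D hD h1 h2

lemma carath {E : Type*} [AddCommGroup E] [Module ℝ E] [FiniteDimensional ℝ E] {s : Set E} {x : E}
    (hx : x ∈ convexHull ℝ s) : ∃ k < Module.finrank ℝ E + 2, ∃ w : Fin k → ℝ, ∃ z : Fin k → E,
      w ∈ stdSimplex ℝ (Fin k) ∧ (∀ i, z i ∈ s) ∧ ∑ i, w i • z i = x := by
  obtain ⟨ι, _, z, w, hz, haff, hw, hw1, hx⟩ := eq_pos_convex_span_of_mem_convexHull hx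
  have hcard := haff.card_le_finrank_succ
  have h2 := Submodule.finrank_le (vectorSpan ℝ (Set.range z))
  let e := (Fintype.equivFin ι).symm
  refine ⟨Fintype.card ι, by omega, w ∘ e, z ∘ e, ⟨fun i => (hw _).le, ?_⟩,
    fun i => hz ⟨_, rfl⟩, ?_⟩
  · rw [← hw1]; exact Equiv.sum_comp e w
  · rw [← hx]; exact Equiv.sum_comp e (fun i => w i • z i)

lemma compact_hull {E : Type*} [NormedAddCommGroup E] [NormedSpace ℝ E] [FiniteDimensional ℝ E]
    {s : Set E} (hs : IsCompact s) : IsCompact (convexHull ℝ s) := by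
  have : convexHull ℝ s = ⋃ k ∈ Finset.range (Module.finrank ℝ E + 2),
      (fun p : (Fin k → ℝ) × (Fin k → E) => ∑ i, p.1 i • p.2 i) ''
        (stdSimplex ℝ (Fin k) ×ˢ Set.univ.pi fun _ => s) := by
    apply Set.Subset.antisymm
    · intro x hx
      obtain ⟨k, hk, w, z, hw, hz, rfl⟩ := carath hx
      simp only [Set.mem_iUnion]
      exact ⟨k, Finset.mem_range.2 hk, (w, z), ⟨hw, fun i _ => hz i⟩, rfl⟩
    · intro x hx
      simp only [Set.mem_iUnion] at hx
      obtain ⟨k, hk, ⟨w, z⟩, ⟨hw, hz⟩, rfl⟩ := hx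
      exact (convex_convexHull ℝ s).sum_mem (fun i _ => hw.1 i) hw.2
        (fun i _ => subset_convexHull ℝ s (hz i trivial))
  rw [this]
  refine Finset.isCompact_biUnion _ fun k _ => ?_
  refine IsCompact.image ((isCompact_stdSimplex ℝ _).prod (isCompact_univ_pi fun _ => hs)) ?_
  fun_prop

lemma trace_vec {n : ℕ} (P : Matrix (Fin n) (Fin n) ℝ) (x : Fin n → ℝ) :
    Matrix.trace (P * Matrix.vecMulVec x x) = qf P x := by
  rw [Matrix.mul_vecMulVec, Matrix.trace_vecMulVec, dotProduct_comm, qf]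

lemma separate {n : ℕ} {Q : Matrix (Fin n) (Fin n) ℝ} (hs : Q.IsSymm) (hQ : ∀ i j, 0 ≤ Q i j)
    (hno : Q ∉ CPcone n) : ∃ B : Matrix (Fin n) (Fin n) ℝ, B.IsSymm ∧ Copos B ∧
      Matrix.trace (B * Q) < 0 := by
  set S : Set (Fin n → Fin n → ℝ) := (fun x : Fin n → ℝ => fun i j => x i * x j) ''
    stdSimplex ℝ (Fin n) with hS
  have hSc : IsCompact S := (isCompact_stdSimplex ℝ _).image (by fun_prop)
  have hQ0 : Q ≠ 0 := by
    rintro rfl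
    exact hno ⟨0, Fin.elim0, Fin.elim0, fun i => i.elim0, fun i => i.elim0, by simp⟩
  set σ : ℝ := ∑ i, ∑ j, Q i j with hσ
  have hσ0 : 0 < σ := by
    obtain ⟨i, j, hij⟩ : ∃ i j, Q i j ≠ 0 := by
      by_contra h; push Not at h; exact hQ0 (by ext i j; exact h i j)
    refine Finset.sum_pos' (fun i _ => Finset.sum_nonneg fun j _ => hQ i j) ⟨i, Finset.mem_univ _, ?_⟩
    exact Finset.sum_pos' (fun j _ => hQ i j)
      ⟨j, Finset.mem_univ _, lt_of_le_of_ne (hQ i j) hij.symm⟩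
  set q : Fin n → Fin n → ℝ := fun i j => σ⁻¹ * Q i j with hq
  have hqS : q ∉ convexHull ℝ S := by
    intro h
    obtain ⟨k, -, w, z, hw, hz, hsum⟩ := carath h
    choose x hx hxz using hz
    refine hno ⟨k, fun i => σ * w i, x, fun i => mul_nonneg hσ0.le (hw.1 i), fun i => (hx i).1, ?_⟩
    ext a b
    have := congrFun (congrFun hsum a) b
    simp only [hq, Finset.sum_apply, Pi.smul_apply, smul_eq_mul] at this
    have h2 : Q a b = σ * (σ⁻¹ * Q a b) := by field_simp
    rw [h2, ← this, Matrix.sum_apply, Finset.mul_sum]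
    refine Finset.sum_congr rfl fun i _ => ?_
    rw [← hxz i]
    simp [Matrix.vecMulVec_apply]; ring
  obtain ⟨f, u, hfq, hfS⟩ := geometric_hahn_banach_point_closed (convex_convexHull ℝ S)
    (compact_hull hSc).isClosed hqS
  set F : Matrix (Fin n) (Fin n) ℝ :=
    Matrix.of fun i j => f (Pi.single i (Pi.single j 1)) - u with hF
  have hfA : ∀ A : Fin n → Fin n → ℝ,
      ∑ i, ∑ j, A i j * F i j = f A - u * ∑ i, ∑ j, A i j := by
    intro A
    have hA : A = ∑ i, ∑ j, A i j • (Pi.single i (Pi.single j 1) : Fin n → Fin n → ℝ) := by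
      ext a b
      simp [Finset.sum_apply, Pi.single_apply, ite_apply]
    have : f A = ∑ i, ∑ j, A i j * f (Pi.single i (Pi.single j 1)) := by
      conv_lhs => rw [hA]
      simp [map_sum]
    rw [this]
    simp only [hF, Matrix.of_apply, mul_sub, Finset.sum_sub_distrib, mul_comm u, Finset.sum_mul]
  have hqfF : ∀ x, qf F x = ∑ i, ∑ j, (x i * x j) * F i j := by
    intro x
    simp only [qf, dotProduct, Matrix.mulVec, Finset.mul_sum]
    exact Finset.sum_congr rfl fun i _ => Finset.sum_congr rfl fun j _ => by ring
  have hFc : Copos F := by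
    intro x hx
    rcases eq_or_ne x 0 with rfl | hx0
    · simp [qf_zero]
    have hsp : 0 < ∑ i, x i := by
      obtain ⟨j, hj⟩ : ∃ j, x j ≠ 0 := by
        by_contra h; push Not at h; exact hx0 (funext h)
      exact Finset.sum_pos' (fun i _ => hx i)
        ⟨j, Finset.mem_univ _, lt_of_le_of_ne (hx j) hj.symm⟩
    set s := ∑ i, x i with hsdef
    set y : Fin n → ℝ := s⁻¹ • x with hy
    have hy1 : ∑ i, y i = 1 := by
      simp only [hy, Pi.smul_apply, smul_eq_mul, ← Finset.mul_sum]
      rw [← hsdef]; field_simp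
    have hyS : y ∈ stdSimplex ℝ (Fin n) := by
      refine ⟨fun i => ?_, hy1⟩
      have := hx i
      simp only [hy, Pi.smul_apply, smul_eq_mul]; positivity
    have h1 := hfS _ (subset_convexHull ℝ S ⟨y, hyS, rfl⟩)
    have h2 : qf F y = f (fun i j => y i * y j) - u := by
      rw [hqfF, hfA (fun i j => y i * y j)]
      simp only [← Finset.mul_sum, ← Finset.sum_mul, hy1]; ring
    have h3 : x = s • y := by rw [hy, smul_smul, mul_inv_cancel₀ hsp.ne', one_smul]
    rw [h3, qf_smul_vec, h2]
    have : 0 ≤ f (fun i j => y i * y j) - u := by linarith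
    positivity
  have hFt : Matrix.trace (F * Q) < 0 := by
    have h1 : Matrix.trace (F * Q) = ∑ i, ∑ j, Q i j * F i j := by
      simp only [Matrix.trace, Matrix.diag, Matrix.mul_apply]
      exact Finset.sum_congr rfl fun i _ => Finset.sum_congr rfl fun j _ => by
        rw [hs.apply, mul_comm]
    have h2 : f (fun i j => Q i j) = σ * f q := by
      rw [← smul_eq_mul, ← map_smul]
      congr 1
      ext i j
      simp only [hq, Pi.smul_apply, smul_eq_mul]; field_simp
    rw [h1, hfA (fun i j => Q i j), h2, ← hσ]
    nlinarith
  refine ⟨F + Fᵀ, by unfold Matrix.IsSymm; rw [Matrix.transpose_add, Matrix.transpose_transpose, add_comm], ?_, ?_⟩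
  · intro x hx
    have : qf Fᵀ x = qf F x := by
      rw [qf, qf, Matrix.mulVec_transpose, dotProduct_comm, Matrix.dotProduct_mulVec]
    rw [qf_add_mat, this]
    have := hFc x hx
    linarith
  · have : Matrix.trace (Fᵀ * Q) = Matrix.trace (F * Q) := by
      rw [← Matrix.trace_transpose, Matrix.transpose_mul, Matrix.transpose_transpose, hs.eq,
        Matrix.trace_mul_comm]
    rw [add_mul, Matrix.trace_add, this]
    linarith

lemma qf_one {n : ℕ} {x : Fin n → ℝ} (hx : x ≠ 0) : 0 < qf (1 : Matrix (Fin n) (Fin n) ℝ) x := by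
  rw [qf, Matrix.one_mulVec]
  refine lt_of_le_of_ne (Finset.sum_nonneg fun i _ => mul_self_nonneg _) ?_
  intro h
  exact hx (dotProduct_self_eq_zero.1 h.symm)

theorem cp_eq_nonneg_with_perfect_certificates (n : ℕ) :
    CPcone n = {Q | Q.IsSymm ∧ (∀ i j, 0 ≤ Q i j) ∧
      ∀ P : Matrix (Fin n) (Fin n) ℝ, IsPerfectCopositive P →
        0 ≤ Matrix.trace (P * Q)} := by
  ext Q
  constructor
  · rintro ⟨m, α, x, hα, hx, rfl⟩
    refine ⟨?_, ?_, ?_⟩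
    · unfold Matrix.IsSymm
      simp [Matrix.transpose_sum, Matrix.transpose_vecMulVec]
    · intro i j
      rw [Matrix.sum_apply]
      refine Finset.sum_nonneg fun k _ => ?_
      simp only [Matrix.smul_apply, Matrix.vecMulVec_apply, smul_eq_mul]
      exact mul_nonneg (hα k) (mul_nonneg (hx k i) (hx k j))
    · intro P hP
      rw [Finset.mul_sum, Matrix.trace_sum]
      refine Finset.sum_nonneg fun k _ => ?_
      rw [Matrix.mul_smul, Matrix.trace_smul, trace_vec, smul_eq_mul]
      refine mul_nonneg (hα k) ?_
      rcases eq_or_ne (x k) 0 with h | h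
      · rw [h, qf_zero]
      · exact (hP.2.1 _ (hx k) h).le
  · rintro ⟨hs, hQ, hP⟩
    by_contra hno
    obtain ⟨B, hBs, hBc, hBt⟩ := separate hs hQ hno
    have htr : 0 ≤ Matrix.trace Q := Finset.sum_nonneg fun i _ => hQ i i
    set ε : ℝ := -Matrix.trace (B * Q) / (2 * (Matrix.trace Q + 1)) with hε
    have hε0 : 0 < ε := by apply div_pos <;> linarith
    have hεt : ε * (2 * (Matrix.trace Q + 1)) = -Matrix.trace (B * Q) := by
      rw [hε]; field_simp
    set Y : Matrix (Fin n) (Fin n) ℝ := B + ε • 1 with hY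
    have hYs : Y.IsSymm := hBs.add (Matrix.isSymm_one.smul ε)
    have hYc : StrictlyCopositive Y := by
      intro x hx hx0
      rw [hY, qf_add_smul]
      have h1 := hBc x hx
      have h2 := mul_pos hε0 (qf_one hx0)
      linarith
    have hYt : Matrix.trace (Y * Q) < 0 := by
      rw [hY, add_mul, Matrix.trace_add, Matrix.smul_mul, one_mul, Matrix.trace_smul, smul_eq_mul]
      nlinarith
    obtain ⟨c, hc, hcb⟩ := strict_bound hYc
    have hR : InR (c⁻¹ • Y) := by
      refine ⟨hYs.smul _, fun v hv hv0 => ?_⟩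
      have h1 := qf_add_smul 0 Y c⁻¹ (intCast v)
      rw [zero_add] at h1
      rw [h1]
      have h2 := hcb (intCast v) (fun i => by simpa [intCast] using hv i)
      have h3 := one_le_norm_intCast hv0
      have h4 : c ≤ qf Y (intCast v) :=
        (le_mul_of_one_le_right hc.le (one_le_pow₀ h3)).trans h2
      have h5 : qf (0 : Matrix (Fin n) (Fin n) ℝ) (intCast v) = 0 := by simp [qf]
      rw [h5, zero_add, ← div_eq_inv_mul, le_div_iff₀ hc, one_mul]
      exact h4
    have hfin := main_ineq hQ hP _ _ rfl hR
    rw [Matrix.smul_mul, Matrix.trace_smul, smul_eq_mul] at hfin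
    have : 0 < c⁻¹ := inv_pos.2 hc
    nlinarith
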